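/- Let n ≥ 1, let Ω = I_n ⊗ [[0,1],[-1,0]], let S₀ be a real symplectic 2n×2n matrix, let ν₁,…,ν_n be reals with each ν_j > 1, let D₀ := diag(ν₁,…,ν_n) ⊗ I₂, E₀ := diag(√(1-ν₁⁻²),…,√(1-ν_n⁻²)) ⊗ I₂, V₀ := S₀ᵀD₀S₀ and R₀ := S₀ᵀ E₀ S₀⁻ᵀ. Let V₅ be a real symmetric positive-definite 2n×2n matrix, and define J₆ := R₀ V₀ (V₅ + V₀)⁻¹. Then the real symmetric matrix (I − J₆)(V₅ + V₀) = V₅ + V₀ − R₀V₀ is positive definite; in particular, I − J₆ is invertible. -/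

import Mathlib

open Matrix
open scoped Kronecker

noncomputable section

/-- The `2n × 2n` standard symplectic form `Ω = I_n ⊗ [[0,1],[-1,0]]`. -/
def Omega (n : ℕ) : Matrix (Fin n × Fin 2) (Fin n × Fin 2) ℝ :=
  (1 : Matrix (Fin n) (Fin n) ℝ) ⊗ₖ !![(0 : ℝ), 1; -1, 0]

theorem Omega_mul_Omega (n : ℕ) : Omega n * Omega n = -1 := by
  have h : !![(0 : ℝ), 1; -1, 0] * !![(0 : ℝ), 1; -1, 0] = -1 := by
    ext i j
    fin_cases i <;> fin_cases j <;> simp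
  rw [Omega, ← Matrix.mul_kronecker_mul, h, mul_one, ← neg_one_smul ℝ (1 : Matrix (Fin 2) _ ℝ),
    Matrix.kronecker_smul, Matrix.one_kronecker_one, neg_one_smul]

theorem isUnit_det_of_transpose_mul_Omega_mul {n : ℕ} {S : Matrix (Fin n × Fin 2) (Fin n × Fin 2) ℝ}
    (hS : Sᵀ * Omega n * S = Omega n) : IsUnit S.det := by
  refine Matrix.isUnit_det_of_left_inverse (B := -(Omega n * (Sᵀ * Omega n))) ?_
  rw [neg_mul, mul_assoc, hS, Omega_mul_Omega, neg_neg]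

theorem posSemidef_diagonal_kronecker_one {n : ℕ} {d : Fin n → ℝ} (hd : ∀ j, 0 ≤ d j) :
    (Matrix.diagonal d ⊗ₖ (1 : Matrix (Fin 2) (Fin 2) ℝ)).PosSemidef :=
  (Matrix.PosSemidef.diagonal hd).kronecker Matrix.PosSemidef.one

/-- With `V₀ = S₀ᵀD₀S₀` in Williamson form, `R₀ = S₀ᵀ E₀ S₀⁻ᵀ`, and `V₅` real symmetric
positive definite, setting `J₆ := R₀ V₀ (V₅ + V₀)⁻¹`, the matrix
`(I − J₆)(V₅ + V₀) = V₅ + V₀ − R₀V₀` is positive definite; in particular `I − J₆`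
is invertible. -/
theorem iMinusJ6_pos_def (n : ℕ) (hn : 1 ≤ n)
    (S₀ : Matrix (Fin n × Fin 2) (Fin n × Fin 2) ℝ)
    (hS₀ : S₀ᵀ * Omega n * S₀ = Omega n)
    (ν : Fin n → ℝ) (hν : ∀ j, 1 < ν j)
    (D₀ E₀ V₀ R₀ : Matrix (Fin n × Fin 2) (Fin n × Fin 2) ℝ)
    (hD₀ : D₀ = (Matrix.diagonal ν) ⊗ₖ (1 : Matrix (Fin 2) (Fin 2) ℝ))
    (hE₀ : E₀ = (Matrix.diagonal fun j => Real.sqrt (1 - ((ν j) ^ 2)⁻¹)) ⊗ₖ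
      (1 : Matrix (Fin 2) (Fin 2) ℝ))
    (hV₀ : V₀ = S₀ᵀ * D₀ * S₀)
    (hR₀ : R₀ = S₀ᵀ * E₀ * (S₀⁻¹)ᵀ)
    (V₅ : Matrix (Fin n × Fin 2) (Fin n × Fin 2) ℝ)
    (hV₅symm : V₅.IsSymm) (hV₅ : V₅.PosDef)
    (J₆ : Matrix (Fin n × Fin 2) (Fin n × Fin 2) ℝ)
    (hJ₆ : J₆ = R₀ * V₀ * (V₅ + V₀)⁻¹) :
    (1 - J₆) * (V₅ + V₀) = V₅ + V₀ - R₀ * V₀ ∧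
    (V₅ + V₀ - R₀ * V₀).PosDef ∧ IsUnit (1 - J₆) := by
  have hdet := isUnit_det_of_transpose_mul_Omega_mul hS₀
  have hV₀psd : V₀.PosSemidef := by
    rw [hV₀, hD₀]
    exact (posSemidef_diagonal_kronecker_one fun j => by linarith [hν j]).conjTranspose_mul_mul_same
      S₀
  have hRV : V₀ - R₀ * V₀ = S₀ᵀ * (D₀ - E₀ * D₀) * S₀ := by
    have hinv : (S₀⁻¹)ᵀ * S₀ᵀ = 1 := by
      rw [← Matrix.transpose_mul, Matrix.mul_nonsing_inv _ hdet, Matrix.transpose_one]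
    have hR : R₀ * V₀ = S₀ᵀ * (E₀ * D₀) * S₀ := by
      rw [hR₀, hV₀]
      calc _ = S₀ᵀ * E₀ * ((S₀⁻¹)ᵀ * S₀ᵀ) * D₀ * S₀ := by simp only [mul_assoc]
        _ = _ := by rw [hinv, mul_one]; simp only [mul_assoc]
    rw [hR, hV₀, mul_sub, sub_mul]
  have hdiff : D₀ - E₀ * D₀ = (Matrix.diagonal fun j =>
      ν j - Real.sqrt (1 - ((ν j) ^ 2)⁻¹) * ν j) ⊗ₖ (1 : Matrix (Fin 2) (Fin 2) ℝ) := by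
    rw [hD₀, hE₀, ← Matrix.mul_kronecker_mul, Matrix.diagonal_mul_diagonal, mul_one,
      ← Matrix.diagonal_sub, sub_eq_iff_eq_add, ← Matrix.add_kronecker, sub_add_cancel]
  have hpsd : (V₀ - R₀ * V₀).PosSemidef := by
    rw [hRV, hdiff]
    refine (posSemidef_diagonal_kronecker_one fun j => ?_).conjTranspose_mul_mul_same S₀
    have hsqrt : Real.sqrt (1 - ((ν j) ^ 2)⁻¹) ≤ 1 :=
      Real.sqrt_le_one.mpr (sub_le_self _ (by positivity))
    nlinarith [hν j]
  have hpos : (V₅ + V₀ - R₀ * V₀).PosDef := by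
    rw [add_sub_assoc]
    exact hV₅.add_posSemidef hpsd
  have heq : (1 - J₆) * (V₅ + V₀) = V₅ + V₀ - R₀ * V₀ := by
    rw [hJ₆, sub_mul, one_mul, Matrix.nonsing_inv_mul_cancel_right _ _
      ((Matrix.isUnit_iff_isUnit_det _).mp (hV₅.add_posSemidef hV₀psd).isUnit)]
  exact ⟨heq, hpos, isUnit_of_mul_isUnit_left (heq ▸ hpos.isUnit)⟩

end
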